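/- With the notation of the context, the following four identities hold at every point where all the tau functions involved are positive and the relevant denominators are nonzero: (a) for 1 ≤ l ≠ l' ≤ p with n_l ≥ 1 and n_{l'} ≥ 1: ∂/∂t_1^{(l)} log( τ^E_{m, n+e_l−e_{l'}} / τ^E_{m, n−e_l+e_{l'}} ) = ( ∂²/∂t_2^{(l)}∂t_1^{(l')} log τ^E_{m,n} ) / ( ∂²/∂t_1^{(l)}∂t_1^{(l')} log τ^E_{m,n} ); (b) for 1 ≤ k ≠ k' ≤ q with m_k ≥ 1 and m_{k'} ≥ 1: ∂/∂s_1^{(k)} log( τ^E_{m−e_k+e_{k'}, n} / τ^E_{m+e_k−e_{k'}, n} ) = ( ∂²/∂s_2^{(k)}∂s_1^{(k')} log τ^E_{m,n} ) / ( ∂²/∂s_1^{(k)}∂s_1^{(k')} log τ^E_{m,n} ); (c) for 1 ≤ k ≤ q, 1 ≤ l ≤ p with m_k ≥ 1 and n_l ≥ 1: ∂/∂t_1^{(l)} log( τ^E_{m+e_k, n+e_l} / τ^E_{m−e_k, n−e_l} ) = ( ∂²/∂t_2^{(l)}∂s_1^{(k)} log τ^E_{m,n} ) / ( ∂²/∂t_1^{(l)}∂s_1^{(k)}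 log τ^E_{m,n} ); (d) for 1 ≤ k ≤ q, 1 ≤ l ≤ p with m_k ≥ 1 and n_l ≥ 1: ∂/∂s_1^{(k)} log( τ^E_{m−e_k, n−e_l} / τ^E_{m+e_k, n+e_l} ) = ( ∂²/∂s_2^{(k)}∂t_1^{(l)} log τ^E_{m,n} ) / ( ∂²/∂s_1^{(k)}∂t_1^{(l)} log τ^E_{m,n} ). -/

import Mathlib

open MeasureTheory Finset

/-- Partial sum `M_k = Σ_{j<k} m_j` of the block sizes. -/
def Msum {q : ℕ} (m : Fin q → ℕ) (k : ℕ) : ℕ :=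
  ∑ j ∈ Finset.univ.filter (fun j : Fin q => (j : ℕ) < k), m j

theorem Msum_add_lt {q : ℕ} (m : Fin q → ℕ) (r : Fin q) (i : Fin (m r)) :
    Msum m (r : ℕ) + (i : ℕ) < ∑ j, m j := by
  have h2 : m r ≤ ∑ j ∈ Finset.univ.filter (fun j : Fin q => ¬ (j : ℕ) < (r : ℕ)), m j :=
    Finset.single_le_sum (fun j _ => Nat.zero_le (m j)) (by simp)
  have h3 : Msum m (r : ℕ) +
      ∑ j ∈ Finset.univ.filter (fun j : Fin q => ¬ (j : ℕ) < (r : ℕ)), m j = ∑ j, m j :=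
    Finset.sum_filter_add_sum_filter_not _ _ _
  have h4 := i.isLt
  omega

/-- The index `M_{r−1} + i` of the `i`-th element of the `r`-th block (`0`-based). -/
def blkIdx {q : ℕ} (m : Fin q → ℕ) (r : Fin q) (i : Fin (m r)) : Fin (∑ j, m j) :=
  ⟨Msum m (r : ℕ) + (i : ℕ), Msum_add_lt m r i⟩

theorem Msum_block_le {q : ℕ} (m : Fin q → ℕ) {u u' : Fin q} (h : u < u') :
    Msum m (u : ℕ) + m u ≤ Msum m (u' : ℕ) := by
  have hsub : insert u (Finset.univ.filter (fun j : Fin q => (j : ℕ) < (u : ℕ)))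
      ⊆ Finset.univ.filter (fun j : Fin q => (j : ℕ) < (u' : ℕ)) := by
    intro j hj
    simp only [Finset.mem_insert, Finset.mem_filter, Finset.mem_univ, true_and] at hj ⊢
    have huu' : (u : ℕ) < (u' : ℕ) := h
    rcases hj with rfl | hj
    · exact huu'
    · omega
  have hle := Finset.sum_le_sum_of_subset (f := m) hsub
  rw [Finset.sum_insert (by simp)] at hle
  unfold Msum
  omega

theorem blkIdx_injective {q : ℕ} (m : Fin q → ℕ) :
    Function.Injective (fun x : Σ r : Fin q, Fin (m r) => blkIdx m x.1 x.2) := by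
  rintro ⟨r, i⟩ ⟨r', i'⟩ h
  have hval : Msum m (r : ℕ) + (i : ℕ) = Msum m (r' : ℕ) + (i' : ℕ) := congrArg Fin.val h
  rcases lt_trichotomy r r' with hlt | heq | hgt
  · exact absurd hval (by have h1 := Msum_block_le m hlt; have h2 := i.isLt; omega)
  · subst heq
    have : i = i' := Fin.ext (by omega)
    rw [this]
  · exact absurd hval (by have h1 := Msum_block_le m hgt; have h2 := i'.isLt; omega)

/-- The canonical (order-preserving) equivalence between `Σ r, Fin (m r)` and `Fin (Σ m)`,
sending `(r, i)` to `M_{r−1} + i`. -/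
noncomputable def blkEquiv {q : ℕ} (m : Fin q → ℕ) : (Σ r : Fin q, Fin (m r)) ≃ Fin (∑ j, m j) :=
  Equiv.ofBijective (fun x => blkIdx m x.1 x.2)
    ((Fintype.bijective_iff_injective_and_card _).mpr
      ⟨blkIdx_injective m, by simp [Fintype.card_sigma]⟩)

/-- The deformed tau function `τ^E_{m,n}(t,s;α,β;a,b)`: the determinant of the `N×N` moment
matrix composed of `p·q` blocks, the `(k,l)` block of size `m_k × n_l` having entries
`∫_E x^{i+j} exp((a_k+b_l)x + (α_k+β_l)x² − Σ_{ν≥1} s_ν^{(k)} x^ν + Σ_{ν≥1} t_ν^{(l)} x^ν − x²/2) dx`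
(defined to be `0` when the total block sizes do not match). -/
noncomputable def tauGen {q p : ℕ} (m : Fin q → ℕ) (n : Fin p → ℕ) (E : Set ℝ)
    (a : Fin q → ℝ) (b : Fin p → ℝ) (al : Fin q → ℝ) (be : Fin p → ℝ)
    (s : Fin q → ℕ → ℝ) (t : Fin p → ℕ → ℝ) : ℝ :=
  if h : ∑ l, n l = ∑ k, m k then
    Matrix.det (Matrix.of fun ri cj : Fin (∑ k, m k) =>
      ∫ x in E,
        x ^ (((((blkEquiv m).symm ri).2 : ℕ)) + ((((blkEquiv n).symm (finCongr h.symm cj)).2 : ℕ))) *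
          Real.exp ((a ((blkEquiv m).symm ri).1 + b ((blkEquiv n).symm (finCongr h.symm cj)).1) * x
            + (al ((blkEquiv m).symm ri).1 + be ((blkEquiv n).symm (finCongr h.symm cj)).1) * x ^ 2
            - (∑ᶠ ν ∈ Set.Ici (1 : ℕ), s ((blkEquiv m).symm ri).1 ν * x ^ ν)
            + (∑ᶠ ν ∈ Set.Ici (1 : ℕ), t ((blkEquiv n).symm (finCongr h.symm cj)).1 ν * x ^ ν)
            - x ^ 2 / 2))
  else 0

/-- The set `E = ⋃_{i=1}^r [c_{2i−1}, c_{2i}]`. -/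
def Eset {r : ℕ} (c : Fin (2 * r) → ℝ) : Set ℝ :=
  ⋃ i : Fin r, Set.Icc (c ⟨2 * (i : ℕ), by have := i.isLt; omega⟩)
    (c ⟨2 * (i : ℕ) + 1, by have := i.isLt; omega⟩)

/-- The space of time parameters `(s^{(1)},…,s^{(q)}; t^{(1)},…,t^{(p)})`. -/
abbrev TS (q p : ℕ) := (Fin q → ℕ → ℝ) × (Fin p → ℕ → ℝ)

/-- Partial derivative `∂/∂s_ν^{(k)}` of a function of the time parameters. -/
noncomputable def dSts {q p : ℕ} (k : Fin q) (ν : ℕ) (f : TS q p → ℝ) : TS q p → ℝ :=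
  fun st => deriv (fun h => f (Function.update st.1 k (Function.update (st.1 k) ν h), st.2))
    (st.1 k ν)

/-- Partial derivative `∂/∂t_ν^{(l)}` of a function of the time parameters. -/
noncomputable def dTts {q p : ℕ} (l : Fin p) (ν : ℕ) (f : TS q p → ℝ) : TS q p → ℝ :=
  fun st => deriv (fun h => f (st.1, Function.update st.2 l (Function.update (st.2 l) ν h)))
    (st.2 l ν)

/-- The tau function `τ^E_{m,n}` as a function of the time variables, with
`E = ⋃_{i=1}^r [c_{2i−1}, c_{2i}]` and all other parameters fixed. -/
noncomputable def TT {q p r : ℕ} (m : Fin q → ℕ) (n : Fin p → ℕ) (c : Fin (2 * r) → ℝ)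
    (a : Fin q → ℝ) (b : Fin p → ℝ) (al : Fin q → ℝ) (be : Fin p → ℝ) : TS q p → ℝ :=
  fun st => tauGen m n (Eset c) a b al be st.1 st.2

open Matrix in
theorem hasDerivAt_det {I : Type*} [Fintype I] [DecidableEq I] {M : ℝ → Matrix I I ℝ}
    {M' : Matrix I I ℝ} {x : ℝ} (hM : ∀ i j, HasDerivAt (fun h => M h i j) (M' i j) x) :
    HasDerivAt (fun h => (M h).det) (∑ j, ((M x).updateCol j (fun i => M' i j)).det) x := by
  have hprod : ∀ σ : Equiv.Perm I, HasDerivAt (fun h => ∏ i, M h (σ i) i)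
      (∑ j, (∏ i ∈ univ.erase j, M x (σ i) i) • M' (σ j) j) x := fun σ =>
    HasDerivAt.fun_finsetProd fun i _ => hM (σ i) i
  have hsum := HasDerivAt.fun_sum (u := univ) fun σ (_ : σ ∈ univ) =>
    (hprod σ).const_mul (((Equiv.Perm.sign σ : ℤˣ) : ℤ) : ℝ)
  simp only [det_apply']
  refine hsum.congr_deriv ?_
  rw [Finset.sum_comm]
  refine Finset.sum_congr rfl fun σ _ => ?_
  rw [Finset.mul_sum]
  refine Finset.sum_congr rfl fun j _ => ?_
  rw [← Finset.mul_prod_erase univ _ (mem_univ j), updateCol_self, smul_eq_mul, mul_comm (M' _ _)]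
  congr 2
  refine Finset.prod_congr rfl fun i hi => ?_
  rw [updateCol_ne (Finset.ne_of_mem_erase hi)]

open Matrix in
theorem hasDerivAt_inv_mulVec {I : Type*} [Fintype I] [DecidableEq I] {M : ℝ → Matrix I I ℝ}
    {M' : Matrix I I ℝ} {v : ℝ → I → ℝ} {v' : I → ℝ} {x : ℝ}
    (hM : ∀ i j, HasDerivAt (fun h => M h i j) (M' i j) x)
    (hv : ∀ i, HasDerivAt (fun h => v h i) (v' i) x) (hdet : (M x).det ≠ 0) (i : I) :
    HasDerivAt (fun h => ((M h)⁻¹ *ᵥ v h) i)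
      (((M x)⁻¹ *ᵥ (v' - M' *ᵥ ((M x)⁻¹ *ᵥ v x))) i) x := by
  have hd := hasDerivAt_det hM
  have hinv : ∀ i j, DifferentiableAt ℝ (fun h => (M h)⁻¹ i j) x := by
    intro i j
    have hadj : DifferentiableAt ℝ (fun h => ((M h).updateRow j (Pi.single i 1)).det) x := by
      refine (hasDerivAt_det (M' := M'.updateRow j 0) fun a b => ?_).differentiableAt
      rcases eq_or_ne a j with rfl | ha
      · simpa using hasDerivAt_const x _
      · simpa [updateRow_ne ha] using hM a b
    simpa only [Matrix.inv_def, Matrix.smul_apply, adjugate_apply, Ring.inverse_eq_inv',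
      smul_eq_mul] using
      (hd.differentiableAt.fun_inv hdet).fun_mul hadj
  have hy : ∀ i, DifferentiableAt ℝ (fun h => ((M h)⁻¹ *ᵥ v h) i) x := by
    intro i
    simp only [mulVec, dotProduct]
    exact DifferentiableAt.fun_sum fun j _ => (hinv i j).fun_mul (hv j).differentiableAt
  set y' : I → ℝ := fun i => deriv (fun h => ((M h)⁻¹ *ᵥ v h) i) x with hy'
  have hev : ∀ᶠ h in nhds x, (M h).det ≠ 0 := hd.continuousAt.eventually_ne hdet
  have key : M' *ᵥ ((M x)⁻¹ *ᵥ v x) + M x *ᵥ y' = v' := by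
    funext a
    have h1 : HasDerivAt (fun h => (M h *ᵥ ((M h)⁻¹ *ᵥ v h)) a)
        ((M' *ᵥ ((M x)⁻¹ *ᵥ v x) + M x *ᵥ y') a) x := by
      have := HasDerivAt.fun_sum (u := univ) fun j (_ : j ∈ univ) =>
        (hM a j).fun_mul (hy j).hasDerivAt
      refine this.congr_deriv ?_
      rw [Finset.sum_add_distrib]
      rfl
    refine h1.unique ((hv a).congr_of_eventuallyEq ?_)
    filter_upwards [hev] with h hh
    rw [mulVec_mulVec, mul_nonsing_inv _ (isUnit_iff_ne_zero.2 hh), one_mulVec]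
  have hsol : (M x)⁻¹ *ᵥ (v' - M' *ᵥ ((M x)⁻¹ *ᵥ v x)) = y' := by
    rw [← key, add_sub_cancel_left, mulVec_mulVec,
      nonsing_inv_mul _ (isUnit_iff_ne_zero.2 hdet), one_mulVec]
  rw [hsol]
  exact (hy i).hasDerivAt

/-- `C` enumerates the labels `(l, j)` with `j < n l`, each exactly once. -/
structure IsEnum {p : ℕ} {I : Type*} (n : Fin p → ℕ) (C : I → Fin p × ℕ) : Prop where
  inj : Function.Injective C
  mem : ∀ l j, (∃ x, C x = (l, j)) ↔ j < n l

/-- The square matrix whose columns are the columns of `A` selected by `C`. -/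
def colMat {p : ℕ} {I : Type*} (A : I → Fin p × ℕ → ℝ) (C : I → Fin p × ℕ) : Matrix I I ℝ :=
  Matrix.of fun i j => A i (C j)

/-- The effect of the derivative in the `ν`-th time of block `l` on a row of moments. -/
def shiftD {p : ℕ} (l : Fin p) (ν : ℕ) (g : Fin p × ℕ → ℝ) : Fin p × ℕ → ℝ :=
  fun x => if x.1 = l then g (l, x.2 + ν) else 0

open Matrix in
/-- The Schur complement of `colMat A C` bordered by the row `ρ` and the column `u`. -/
noncomputable def schur {p : ℕ} {I : Type*} [Fintype I] [DecidableEq I]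
    (A : I → Fin p × ℕ → ℝ) (C : I → Fin p × ℕ) (ρ : Fin p × ℕ → ℝ) (u : Fin p × ℕ) : ℝ :=
  ρ u - (fun j => ρ (C j)) ⬝ᵥ ((colMat A C)⁻¹ *ᵥ fun i => A i u)

section Algebra

open Matrix

variable {p : ℕ} {I : Type*} [Fintype I] [DecidableEq I]

theorem inv_mulVec_col {A : I → Fin p × ℕ → ℝ} {C : I → Fin p × ℕ}
    (hdet : (colMat A C).det ≠ 0) (j : I) :
    ((colMat A C)⁻¹ *ᵥ fun i => A i (C j)) = Pi.single j 1 := by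
  have : (fun i => A i (C j)) = colMat A C *ᵥ Pi.single j 1 := by
    rw [mulVec_single_one]; rfl
  rw [this, mulVec_mulVec, nonsing_inv_mul _ (isUnit_iff_ne_zero.2 hdet), one_mulVec]

theorem schur_col {A : I → Fin p × ℕ → ℝ} {C : I → Fin p × ℕ}
    (hdet : (colMat A C).det ≠ 0) (ρ : Fin p × ℕ → ℝ) (j : I) : schur A C ρ (C j) = 0 := by
  rw [schur, inv_mulVec_col hdet]
  simp

theorem dotProduct_shiftD_sub (A : I → Fin p × ℕ → ℝ) (C : I → Fin p × ℕ) (ρ : Fin p × ℕ → ℝ)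
    (y : I → ℝ) (l : Fin p) (ν : ℕ) :
    (fun j => shiftD l ν ρ (C j)) ⬝ᵥ y
        - (fun j => ρ (C j)) ⬝ᵥ
          ((colMat A C)⁻¹ *ᵥ (colMat (fun i => shiftD l ν (A i)) C *ᵥ y)) =
      ∑ j, if (C j).1 = l then schur A C ρ (l, (C j).2 + ν) * y j else 0 := by
  have hM : colMat (fun i => shiftD l ν (A i)) C *ᵥ y
      = ∑ j, y j • fun i => shiftD l ν (A i) (C j) := by
    funext i
    simp [mulVec, dotProduct, colMat, mul_comm]
  rw [hM, mulVec_sum, dotProduct_sum, dotProduct, ← Finset.sum_sub_distrib]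
  refine Finset.sum_congr rfl fun j _ => ?_
  rw [mulVec_smul, dotProduct_smul]
  by_cases hj : (C j).1 = l
  · simp only [shiftD, hj, if_true, schur, smul_eq_mul]
    ring
  · simp only [shiftD, hj, if_false]
    have : (fun _ : I => (0 : ℝ)) = 0 := rfl
    simp [this]

variable {n : Fin p → ℕ} {C : I → Fin p × ℕ} {A : I → Fin p × ℕ → ℝ} {l : Fin p} {c : I}

theorem dotProduct_shiftD_one (hC : IsEnum n C) (hdet : (colMat A C).det ≠ 0)
    (hn : 1 ≤ n l) (hc : C c = (l, n l - 1)) (ρ : Fin p × ℕ → ℝ) (y : I → ℝ) :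
    (fun j => shiftD l 1 ρ (C j)) ⬝ᵥ y
        - (fun j => ρ (C j)) ⬝ᵥ
          ((colMat A C)⁻¹ *ᵥ (colMat (fun i => shiftD l 1 (A i)) C *ᵥ y)) =
      schur A C ρ (l, n l) * y c := by
  rw [dotProduct_shiftD_sub, Finset.sum_eq_single c]
  · simp [hc, Nat.sub_add_cancel hn]
  · intro j _ hj
    split_ifs with hl
    · have hlt : (C j).2 < n l := (hC.mem l _).1 ⟨j, by rw [← hl]⟩
      have hne : (C j).2 ≠ n l - 1 := fun h => hj (hC.inj (hc ▸ Prod.ext hl h))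
      obtain ⟨j', hj'⟩ := (hC.mem l ((C j).2 + 1)).2 (by omega)
      rw [← hj', schur_col hdet, zero_mul]
    · rfl
  · simp

/-- The entry of `y` at the last but one label of block `l`, or `0` if the block has length one. -/
noncomputable def penult (n : Fin p → ℕ) (C : I → Fin p × ℕ) (l : Fin p) (y : I → ℝ) : ℝ :=
  ∑ j, if (C j).1 = l ∧ (C j).2 + 2 = n l then y j else 0

theorem dotProduct_shiftD_two (hC : IsEnum n C) (hdet : (colMat A C).det ≠ 0)
    (hn : 1 ≤ n l) (hc : C c = (l, n l - 1)) (ρ : Fin p × ℕ → ℝ) (y : I → ℝ) :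
    (fun j => shiftD l 2 ρ (C j)) ⬝ᵥ y
        - (fun j => ρ (C j)) ⬝ᵥ
          ((colMat A C)⁻¹ *ᵥ (colMat (fun i => shiftD l 2 (A i)) C *ᵥ y)) =
      schur A C ρ (l, n l + 1) * y c + schur A C ρ (l, n l) * penult n C l y := by
  have hsplit : ∀ j, (if (C j).1 = l then schur A C ρ (l, (C j).2 + 2) * y j else 0) =
      (if j = c then schur A C ρ (l, n l + 1) * y c else 0) +
        schur A C ρ (l, n l) * (if (C j).1 = l ∧ (C j).2 + 2 = n l then y j else 0) := by
    intro j
    by_cases hjc : j = c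
    · subst hjc
      have h1 : n l - 1 + 2 = n l + 1 := by omega
      simp [hc, h1]
    · by_cases hl : (C j).1 = l
      · have hlt : (C j).2 < n l := (hC.mem l _).1 ⟨j, by rw [← hl]⟩
        have hne : (C j).2 ≠ n l - 1 := fun h => hjc (hC.inj (hc ▸ Prod.ext hl h))
        by_cases h2 : (C j).2 + 2 = n l
        · simp [hl, hjc, h2]
        · obtain ⟨j', hj'⟩ := (hC.mem l ((C j).2 + 2)).2 (by omega)
          simp [hl, hjc, h2, ← hj', schur_col hdet]
      · simp [hl, hjc]
  rw [dotProduct_shiftD_sub, Finset.sum_congr rfl fun j _ => hsplit j, Finset.sum_add_distrib,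
    ← Finset.mul_sum]
  simp [penult]

theorem colMat_shiftD_apply (hC : IsEnum n C) (hdet : (colMat A C).det ≠ 0)
    (hn : 1 ≤ n l) (hc : C c = (l, n l - 1)) (y : I → ℝ) :
    ((colMat A C)⁻¹ *ᵥ (colMat (fun i => shiftD l 1 (A i)) C *ᵥ y)) c =
      penult n C l y + ((colMat A C)⁻¹ *ᵥ fun i => A i (l, n l)) c * y c := by
  have hne : ∀ j, C j ≠ (l, n l) := fun j h => lt_irrefl _ ((hC.mem l (n l)).1 ⟨j, h⟩)
  have h := dotProduct_shiftD_one hC hdet hn hc (fun x => if x = C c then 1 else 0) y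
  have he : (fun j => if C j = C c then (1 : ℝ) else 0) = Pi.single c 1 := by
    funext j
    simp [Pi.single_apply, hC.inj.eq_iff]
  have hp : (fun j => shiftD l 1 (fun x => if x = C c then (1 : ℝ) else 0) (C j)) ⬝ᵥ y
      = penult n C l y := by
    simp only [penult, dotProduct, shiftD]
    refine Finset.sum_congr rfl fun j _ => ?_
    by_cases hl : (C j).1 = l
    · have : (C j).2 + 1 = n l - 1 ↔ (C j).2 + 2 = n l := by omega
      simp [hl, hc, this]
    · simp [hl]
  rw [hp, schur, he, single_one_dotProduct, single_one_dotProduct, if_neg (hne c).symm] at h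
  linarith

end Algebra

section Derivatives

open Matrix

variable {p : ℕ} {I : Type*} [Fintype I] [DecidableEq I] {n : Fin p → ℕ} {C : I → Fin p × ℕ}
  {A : ℝ → I → Fin p × ℕ → ℝ} {ρ : ℝ → Fin p × ℕ → ℝ} {v : ℝ → I → ℝ} {l : Fin p} {c : I} {x : ℝ}
  {ν : ℕ}

theorem hasDerivAt_dotProduct_inv_mulVec {v' : I → ℝ}
    (hA : ∀ i u, HasDerivAt (fun h => A h i u) (shiftD l ν (A x i) u) x)
    (hρ : ∀ u, HasDerivAt (fun h => ρ h u) (shiftD l ν (ρ x) u) x)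
    (hv : ∀ i, HasDerivAt (fun h => v h i) (v' i) x) (hdet : (colMat (A x) C).det ≠ 0) :
    HasDerivAt (fun h => (fun j => ρ h (C j)) ⬝ᵥ ((colMat (A h) C)⁻¹ *ᵥ v h))
      ((fun j => shiftD l ν (ρ x) (C j)) ⬝ᵥ ((colMat (A x) C)⁻¹ *ᵥ v x)
        - (fun j => ρ x (C j)) ⬝ᵥ ((colMat (A x) C)⁻¹ *ᵥ
            (colMat (fun i => shiftD l ν (A x i)) C *ᵥ ((colMat (A x) C)⁻¹ *ᵥ v x)))
        + (fun j => ρ x (C j)) ⬝ᵥ ((colMat (A x) C)⁻¹ *ᵥ v')) x := by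
  have h := hasDerivAt_inv_mulVec (M := fun h => colMat (A h) C)
    (M' := colMat (fun i => shiftD l ν (A x i)) C) (fun i j => hA i (C j)) hv hdet
  have hs := HasDerivAt.fun_sum (u := Finset.univ) fun j (_ : j ∈ Finset.univ) =>
    (hρ (C j)).fun_mul (h j)
  refine hs.congr_deriv ?_
  rw [Finset.sum_add_distrib, mulVec_sub, ← sub_eq_zero]
  simp only [dotProduct, Pi.sub_apply, mul_sub, Finset.sum_sub_distrib]
  ring

theorem hasDerivAt_dotProduct_one (hC : IsEnum n C) (hn : 1 ≤ n l) (hc : C c = (l, n l - 1))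
    (hA : ∀ i u, HasDerivAt (fun h => A h i u) (shiftD l 1 (A x i) u) x)
    (hρ : ∀ u, HasDerivAt (fun h => ρ h u) (shiftD l 1 (ρ x) u) x)
    (hv : ∀ i, HasDerivAt (fun h => v h i) 0 x) (hdet : (colMat (A x) C).det ≠ 0) :
    HasDerivAt (fun h => (fun j => ρ h (C j)) ⬝ᵥ ((colMat (A h) C)⁻¹ *ᵥ v h))
      (schur (A x) C (ρ x) (l, n l) * ((colMat (A x) C)⁻¹ *ᵥ v x) c) x := by
  refine (hasDerivAt_dotProduct_inv_mulVec (v' := 0) hA hρ hv hdet).congr_deriv ?_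
  rw [dotProduct_shiftD_one hC hdet hn hc]
  simp

theorem hasDerivAt_dotProduct_two (hC : IsEnum n C) (hn : 1 ≤ n l) (hc : C c = (l, n l - 1))
    (hA : ∀ i u, HasDerivAt (fun h => A h i u) (shiftD l 2 (A x i) u) x)
    (hρ : ∀ u, HasDerivAt (fun h => ρ h u) (shiftD l 2 (ρ x) u) x)
    (hv : ∀ i, HasDerivAt (fun h => v h i) 0 x) (hdet : (colMat (A x) C).det ≠ 0) :
    HasDerivAt (fun h => (fun j => ρ h (C j)) ⬝ᵥ ((colMat (A h) C)⁻¹ *ᵥ v h))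
      (schur (A x) C (ρ x) (l, n l + 1) * ((colMat (A x) C)⁻¹ *ᵥ v x) c
        + schur (A x) C (ρ x) (l, n l) * penult n C l ((colMat (A x) C)⁻¹ *ᵥ v x)) x := by
  refine (hasDerivAt_dotProduct_inv_mulVec (v' := 0) hA hρ hv hdet).congr_deriv ?_
  rw [dotProduct_shiftD_two hC hdet hn hc]
  simp

theorem hasDerivAt_schur (hC : IsEnum n C) (hn : 1 ≤ n l) (hc : C c = (l, n l - 1))
    (hA : ∀ i u, HasDerivAt (fun h => A h i u) (shiftD l 1 (A x i) u) x)
    (hρ : ∀ u, HasDerivAt (fun h => ρ h u) (shiftD l 1 (ρ x) u) x)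
    (hdet : (colMat (A x) C).det ≠ 0) :
    HasDerivAt (fun h => schur (A h) C (ρ h) (l, n l))
      (schur (A x) C (ρ x) (l, n l + 1) - schur (A x) C (ρ x) (l, n l) *
        ((colMat (A x) C)⁻¹ *ᵥ fun i => A x i (l, n l)) c) x := by
  refine ((hρ (l, n l)).fun_sub
    (hasDerivAt_dotProduct_inv_mulVec (v := fun h i => A h i (l, n l))
      hA hρ (fun i => hA i (l, n l)) hdet)).congr_deriv ?_
  rw [dotProduct_shiftD_one hC hdet hn hc]
  simp only [shiftD, if_true, schur]
  ring

theorem hasDerivAt_inv_mulVec_apply (hC : IsEnum n C) (hn : 1 ≤ n l) (hc : C c = (l, n l - 1))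
    (hA : ∀ i u, HasDerivAt (fun h => A h i u) (shiftD l 1 (A x i) u) x)
    (hv : ∀ i, HasDerivAt (fun h => v h i) 0 x) (hdet : (colMat (A x) C).det ≠ 0) :
    HasDerivAt (fun h => ((colMat (A h) C)⁻¹ *ᵥ v h) c)
      (-(penult n C l ((colMat (A x) C)⁻¹ *ᵥ v x)
        + ((colMat (A x) C)⁻¹ *ᵥ fun i => A x i (l, n l)) c
          * ((colMat (A x) C)⁻¹ *ᵥ v x) c)) x := by
  refine (hasDerivAt_inv_mulVec (M := fun h => colMat (A h) C)
    (M' := colMat (fun i => shiftD l 1 (A x i)) C) (v' := 0)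
    (fun i j => hA i (C j)) hv hdet c).congr_deriv ?_
  rw [zero_sub, mulVec_neg, Pi.neg_apply, colMat_shiftD_apply hC hdet hn hc]

theorem hasDerivAt_log_schur_div (hC : IsEnum n C) (hn : 1 ≤ n l) (hc : C c = (l, n l - 1))
    (hA : ∀ i u, HasDerivAt (fun h => A h i u) (shiftD l 1 (A x i) u) x)
    (hρ : ∀ u, HasDerivAt (fun h => ρ h u) (shiftD l 1 (ρ x) u) x)
    (hv : ∀ i, HasDerivAt (fun h => v h i) 0 x) (hdet : (colMat (A x) C).det ≠ 0)
    (hs : schur (A x) C (ρ x) (l, n l) ≠ 0) (hy : ((colMat (A x) C)⁻¹ *ᵥ v x) c ≠ 0) :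
    HasDerivAt (fun h => Real.log (schur (A h) C (ρ h) (l, n l) / ((colMat (A h) C)⁻¹ *ᵥ v h) c))
      ((schur (A x) C (ρ x) (l, n l + 1) * ((colMat (A x) C)⁻¹ *ᵥ v x) c
        + schur (A x) C (ρ x) (l, n l) * penult n C l ((colMat (A x) C)⁻¹ *ᵥ v x)) /
        (schur (A x) C (ρ x) (l, n l) * ((colMat (A x) C)⁻¹ *ᵥ v x) c)) x := by
  refine (((hasDerivAt_schur hC hn hc hA hρ hdet).fun_div
    (hasDerivAt_inv_mulVec_apply hC hn hc hA hv hdet) hy).log (div_ne_zero hs hy)).congr_deriv ?_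
  field_simp
  ring

/-- Derivative of the logarithm of the determinant in the first time of a column block. -/
theorem hasDerivAt_log_det (hC : IsEnum n C) (hn : 1 ≤ n l) (hc : C c = (l, n l - 1))
    (hA : ∀ i u, HasDerivAt (fun h => A h i u) (shiftD l 1 (A x i) u) x)
    (hdet : (colMat (A x) C).det ≠ 0) :
    HasDerivAt (fun h => Real.log (colMat (A h) C).det)
      (((colMat (A x) C)⁻¹ *ᵥ fun i => A x i (l, n l)) c) x := by
  refine ((hasDerivAt_det (M := fun h => colMat (A h) C)
    (M' := colMat (fun i => shiftD l 1 (A x i)) C) (fun i j => hA i (C j))).log hdet).congr_deriv ?_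
  rw [div_eq_iff hdet, Finset.sum_eq_single c]
  · have := congrFun (det_smul_inv_mulVec_eq_cramer (colMat (A x) C) (fun i => A x i (l, n l))
      (isUnit_iff_ne_zero.2 hdet)) c
    rw [cramer_apply, Pi.smul_apply, smul_eq_mul, mul_comm] at this
    rw [this]
    congr 2
    funext i
    simp [colMat, shiftD, hc, Nat.sub_add_cancel hn]
  · intro j _ hj
    by_cases hl : (C j).1 = l
    · have hlt : (C j).2 < n l := (hC.mem l _).1 ⟨j, by rw [← hl]⟩
      have hne : (C j).2 ≠ n l - 1 := fun h => hj (hC.inj (hc ▸ Prod.ext hl h))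
      obtain ⟨j', hj'⟩ := (hC.mem l ((C j).2 + 1)).2 (by omega)
      have hjj : j ≠ j' := by
        rintro rfl
        simpa using congrArg Prod.snd hj'
      refine det_zero_of_column_eq hjj fun i => ?_
      rw [updateCol_self, updateCol_ne hjj.symm]
      simp [colMat, shiftD, hl, hj']
    · refine det_eq_zero_of_column_eq_zero j fun i => ?_
      simp [colMat, shiftD, hl]
  · simp

end Derivatives

section Moments

open Topology

/-- The time parameters have finitely many nonzero entries. -/
def FinTimes {q p : ℕ} (st : TS q p) : Prop :=
  (∀ i, (Function.support (st.1 i)).Finite) ∧ ∀ i, (Function.support (st.2 i)).Finite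

/-- The line through `st` in the direction of the `ν`-th time of column block `l`. -/
def tLine {q p : ℕ} (l : Fin p) (ν : ℕ) (st : TS q p) (h : ℝ) : TS q p :=
  (st.1, Function.update st.2 l (Function.update (st.2 l) ν h))

theorem tLine_self {q p : ℕ} (l : Fin p) (ν : ℕ) (st : TS q p) : tLine l ν st (st.2 l ν) = st := by
  simp [tLine]

theorem finTimes_tLine {q p : ℕ} {st : TS q p} (hst : FinTimes st) (l : Fin p) (ν : ℕ) (h : ℝ) :
    FinTimes (tLine l ν st h) := by
  refine ⟨hst.1, fun i => ?_⟩
  rcases eq_or_ne i l with rfl | hi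
  · refine ((hst.2 i).insert ν).subset fun j hj => ?_
    rcases eq_or_ne j ν with rfl | hne
    · exact Set.mem_insert _ _
    · refine Set.mem_insert_of_mem _ ?_
      simpa [tLine, hne] using hj
  · simpa [tLine, hi] using hst.2 i

theorem finsum_times_eq {s : ℕ → ℝ} {S : Finset ℕ} (hS : Function.support s ⊆ S) (x : ℝ) :
    (∑ᶠ ν ∈ Set.Ici (1 : ℕ), s ν * x ^ ν) = ∑ ν ∈ S with 1 ≤ ν, s ν * x ^ ν := by
  refine finsum_mem_eq_sum_of_inter_support_eq _ ?_
  ext ν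
  simp only [Set.mem_inter_iff, Set.mem_Ici, Function.mem_support, Finset.coe_filter,
    Set.mem_ofPred_eq]
  constructor
  · rintro ⟨h1, h2⟩
    exact ⟨⟨hS (left_ne_zero_of_mul h2), h1⟩, h2⟩
  · rintro ⟨⟨_, h1⟩, h2⟩
    exact ⟨h1, h2⟩

theorem continuous_finsum_times {s : ℕ → ℝ} (hs : (Function.support s).Finite) :
    Continuous fun x : ℝ => ∑ᶠ ν ∈ Set.Ici (1 : ℕ), s ν * x ^ ν := by
  have hS : Function.support s ⊆ (hs.toFinset : Set ℕ) := by simp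
  simp only [finsum_times_eq hS]
  fun_prop

theorem finsum_times_update {s : ℕ → ℝ} (hs : (Function.support s).Finite) {ν : ℕ} (hν : 1 ≤ ν)
    (h x : ℝ) :
    (∑ᶠ i ∈ Set.Ici (1 : ℕ), Function.update s ν h i * x ^ i) =
      (∑ᶠ i ∈ Set.Ici (1 : ℕ), s i * x ^ i) + (h - s ν) * x ^ ν := by
  have hS : Function.support s ⊆ (insert ν hs.toFinset : Finset ℕ) := fun j hj => by
    simp only [Finset.coe_insert, Set.Finite.coe_toFinset]
    exact Set.mem_insert_of_mem _ hj
  have hS' : Function.support (Function.update s ν h) ⊆ (insert ν hs.toFinset : Finset ℕ) := by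
    intro j hj
    rcases eq_or_ne j ν with rfl | hne
    · simp
    · exact hS (by simpa [hne] using hj)
  have hupd : ∀ i, Function.update s ν h i * x ^ i
      = s i * x ^ i + if i = ν then (h - s ν) * x ^ ν else 0 := by
    intro i
    rcases eq_or_ne i ν with rfl | hne
    · simp only [Function.update_self, if_true]
      ring
    · simp [hne]
  rw [finsum_times_eq hS, finsum_times_eq hS', Finset.sum_congr rfl fun i _ => hupd i,
    Finset.sum_add_distrib, Finset.sum_ite_eq']
  simp [hν]

theorem isCompact_Eset {r : ℕ} (c : Fin (2 * r) → ℝ) : IsCompact (Eset c) :=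
  isCompact_iUnion fun _ => isCompact_Icc

/-- The moments, i.e. the entries of the matrix defining the tau functions. -/
noncomputable def moment {q p r : ℕ} (c : Fin (2 * r) → ℝ) (a : Fin q → ℝ) (b : Fin p → ℝ)
    (al : Fin q → ℝ) (be : Fin p → ℝ) (st : TS q p) (k : Fin q) (l : Fin p) (d : ℕ) : ℝ :=
  ∫ x in Eset c, x ^ d * Real.exp ((a k + b l) * x + (al k + be l) * x ^ 2
    - (∑ᶠ ν ∈ Set.Ici (1 : ℕ), st.1 k ν * x ^ ν)
    + (∑ᶠ ν ∈ Set.Ici (1 : ℕ), st.2 l ν * x ^ ν) - x ^ 2 / 2)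

theorem hasDerivAt_integral_exp {E : Set ℝ} (hE : IsCompact E) {Q : ℝ → ℝ} (hQ : Continuous Q)
    (d ν : ℕ) (h₀ : ℝ) :
    HasDerivAt (fun h => ∫ x in E, x ^ d * Real.exp (Q x + (h - h₀) * x ^ ν))
      (∫ x in E, x ^ (d + ν) * Real.exp (Q x)) h₀ := by
  have hcont : Continuous fun z : ℝ × ℝ =>
      z.2 ^ (d + ν) * Real.exp (Q z.2 + (z.1 - h₀) * z.2 ^ ν) := by fun_prop
  obtain ⟨B, hB⟩ := ((isCompact_closedBall h₀ 1).prod hE).exists_bound_of_continuousOn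
    hcont.continuousOn
  have hfin : volume E < ⊤ := hE.measure_lt_top
  have hmeas : MeasurableSet E := hE.measurableSet
  have hF : ∀ h : ℝ, Continuous fun x => x ^ d * Real.exp (Q x + (h - h₀) * x ^ ν) := by
    intro h; fun_prop
  have hF' : ∀ h : ℝ, Continuous fun x => x ^ (d + ν) * Real.exp (Q x + (h - h₀) * x ^ ν) := by
    intro h; fun_prop
  have key := (hasDerivAt_integral_of_dominated_loc_of_deriv_le (μ := volume.restrict E)
    (F := fun h x => x ^ d * Real.exp (Q x + (h - h₀) * x ^ ν))
    (F' := fun h x => x ^ (d + ν) * Real.exp (Q x + (h - h₀) * x ^ ν))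
    (bound := fun _ => B) (Metric.closedBall_mem_nhds h₀ one_pos)
    (Filter.Eventually.of_forall fun h => (hF h).aestronglyMeasurable)
    ((hF h₀).continuousOn.integrableOn_compact hE)
    (hF' h₀).aestronglyMeasurable
    ((ae_restrict_iff' hmeas).2 (Filter.Eventually.of_forall fun x hx h hh => hB (h, x) ⟨hh, hx⟩))
    (integrableOn_const hfin.ne)
    (Filter.Eventually.of_forall fun x h _ => ?_)).2
  · simpa using key
  · have h1 : HasDerivAt (fun h : ℝ => Q x + (h - h₀) * x ^ ν) (x ^ ν) h := by
      simpa using (((hasDerivAt_id h).sub_const h₀).mul_const (x ^ ν)).const_add (Q x)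
    refine (h1.exp.const_mul (x ^ d)).congr_deriv ?_
    ring

theorem hasDerivAt_moment {q p r : ℕ} (c : Fin (2 * r) → ℝ) (a : Fin q → ℝ) (b : Fin p → ℝ)
    (al : Fin q → ℝ) (be : Fin p → ℝ) {st : TS q p} (hst : FinTimes st) (k : Fin q) (l : Fin p)
    {ν : ℕ} (hν : 1 ≤ ν) (d : ℕ) (u : Fin p × ℕ) :
    HasDerivAt (fun h => moment c a b al be (tLine l ν st h) k u.1 (d + u.2))
      (shiftD l ν (fun u => moment c a b al be st k u.1 (d + u.2)) u) (st.2 l ν) := by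
  obtain ⟨l', j⟩ := u
  rcases eq_or_ne l' l with rfl | hl
  · have hc1 := continuous_finsum_times (hst.1 k)
    have hc2 := continuous_finsum_times (hst.2 l')
    have h := hasDerivAt_integral_exp (isCompact_Eset c)
      (Q := fun x => (a k + b l') * x + (al k + be l') * x ^ 2
        - (∑ᶠ ν ∈ Set.Ici (1 : ℕ), st.1 k ν * x ^ ν)
        + (∑ᶠ ν ∈ Set.Ici (1 : ℕ), st.2 l' ν * x ^ ν) - x ^ 2 / 2)
      (by fun_prop) (d + j) ν (st.2 l' ν)
    simp only [shiftD, if_true, moment, ← add_assoc]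
    convert h using 6 with h x
    simp only [tLine, Function.update_self, finsum_times_update (hst.2 l') hν]
    ring
  · simpa [shiftD, hl, moment, tLine] using hasDerivAt_const (st.2 l ν) _

end Moments

section Enumerations

open Matrix

theorem exists_isEnum_pair {q p : ℕ} {m : Fin q → ℕ} {n : Fin p → ℕ} (h : ∑ l, n l = ∑ k, m k) :
    ∃ (R : (Σ k, Fin (m k)) → Fin q × ℕ) (C : (Σ k, Fin (m k)) → Fin p × ℕ),
      IsEnum m R ∧ IsEnum n C := by
  have std : ∀ {q : ℕ} (m : Fin q → ℕ),
      IsEnum m (fun x : Σ k, Fin (m k) => (x.1, (x.2 : ℕ))) := by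
    intro q m
    refine ⟨?_, fun k i => ⟨?_, fun hi => ⟨⟨k, i, hi⟩, rfl⟩⟩⟩
    · rintro ⟨k, i⟩ ⟨k', i'⟩ hx
      obtain ⟨rfl, hi⟩ := Prod.mk.inj hx
      exact congrArg _ (Fin.ext hi)
    · rintro ⟨⟨k', i'⟩, hx⟩
      obtain ⟨rfl, rfl⟩ := Prod.mk.inj hx
      exact i'.isLt
  have e : (Σ k, Fin (m k)) ≃ Σ l, Fin (n l) := Fintype.equivOfCardEq (by simp [h])
  refine ⟨_, fun x => ((e x).1, ((e x).2 : ℕ)), std m, ⟨(std n).inj.comp e.injective, ?_⟩⟩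
  intro l j
  rw [← (std n).mem l j]
  exact (e.surjective.exists (p := fun y => (y.1, (y.2 : ℕ)) = (l, j))).symm

theorem IsEnum.update {p : ℕ} {I : Type*} [DecidableEq I] {n : Fin p → ℕ} {C : I → Fin p × ℕ}
    (hC : IsEnum n C) {l l' : Fin p} (hl : l ≠ l') (hn : 1 ≤ n l') {c' : I}
    (hc : C c' = (l', n l' - 1)) :
    IsEnum (Function.update (Function.update n l (n l + 1)) l' (n l' - 1))
      (Function.update C c' (l, n l)) := by
  have hne : ∀ j, C j ≠ (l, n l) := fun j h => lt_irrefl _ ((hC.mem l (n l)).1 ⟨j, h⟩)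
  constructor
  · intro x y hxy
    by_cases hx : x = c' <;> by_cases hy : y = c'
    · rw [hx, hy]
    · rw [hx, Function.update_self, Function.update_of_ne hy] at hxy
      exact absurd hxy.symm (hne y)
    · rw [hy, Function.update_self, Function.update_of_ne hx] at hxy
      exact absurd hxy (hne x)
    · rw [Function.update_of_ne hy, Function.update_of_ne hx] at hxy
      exact hC.inj hxy
  · intro a j
    have hex : (∃ x, Function.update C c' (l, n l) x = (a, j)) ↔
        (a = l ∧ j = n l) ∨ (j < n a ∧ ¬ (a = l' ∧ j = n l' - 1)) := by
      constructor
      · rintro ⟨x, hx⟩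
        by_cases hxc : x = c'
        · rw [hxc, Function.update_self] at hx
          obtain ⟨rfl, rfl⟩ := Prod.mk.inj hx
          exact Or.inl ⟨rfl, rfl⟩
        · rw [Function.update_of_ne hxc] at hx
          refine Or.inr ⟨(hC.mem a j).1 ⟨x, hx⟩, ?_⟩
          rintro ⟨rfl, rfl⟩
          exact hxc (hC.inj (hx.trans hc.symm))
      · rintro (⟨rfl, rfl⟩ | ⟨h1, h2⟩)
        · exact ⟨c', Function.update_self ..⟩
        · obtain ⟨x, hx⟩ := (hC.mem a j).2 h1
          refine ⟨x, ?_⟩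
          rw [Function.update_of_ne, hx]
          rintro rfl
          exact h2 (Prod.mk.inj (hx.symm.trans hc))
    rw [hex]
    rcases eq_or_ne a l' with rfl | ha'
    · simp only [Function.update_self, hl.symm, false_and, false_or, true_and]
      omega
    · rcases eq_or_ne a l with rfl | ha
      · simp only [Function.update_of_ne ha', Function.update_self, ha', false_and, true_and,
          not_false_eq_true, and_true]
        omega
      · simp [ha, ha']

theorem IsEnum.option {p : ℕ} {I : Type*} {n : Fin p → ℕ} {C : I → Fin p × ℕ}
    (hC : IsEnum n C) (l : Fin p) :
    IsEnum (Function.update n l (n l + 1)) (fun o : Option I => o.elim (l, n l) C) := by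
  have hne : ∀ j, C j ≠ (l, n l) := fun j h => lt_irrefl _ ((hC.mem l (n l)).1 ⟨j, h⟩)
  constructor
  · rintro (_ | x) (_ | y) hxy
    · rfl
    · exact absurd hxy.symm (hne y)
    · exact absurd hxy (hne x)
    · exact congrArg some (hC.inj hxy)
  · intro a j
    rw [Option.exists]
    simp only [Option.elim_none, Option.elim_some, hC.mem, Prod.mk.injEq]
    rcases eq_or_ne a l with rfl | ha
    · simp only [Function.update_self, true_and]
      omega
    · simp [ha, ha.symm]

/-- The rows of moments selected by `R`. -/
noncomputable def momentRows {q p r : ℕ} {I : Type*} (c : Fin (2 * r) → ℝ) (a : Fin q → ℝ)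
    (b : Fin p → ℝ) (al : Fin q → ℝ) (be : Fin p → ℝ) (R : I → Fin q × ℕ) (st : TS q p) :
    I → Fin p × ℕ → ℝ :=
  fun i u => moment c a b al be st (R i).1 u.1 ((R i).2 + u.2)

theorem IsEnum.exists_equiv {q : ℕ} {I : Type*} {m : Fin q → ℕ} {R : I → Fin q × ℕ}
    (hR : IsEnum m R) :
    ∃ e : I ≃ Fin (∑ k, m k), ∀ i, R i =
      (((blkEquiv m).symm (e i)).1, (((blkEquiv m).symm (e i)).2 : ℕ)) := by
  let f : I → Σ k, Fin (m k) := fun i => ⟨(R i).1, (R i).2, (hR.mem _ _).1 ⟨i, rfl⟩⟩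
  have hf : Function.Bijective f := by
    refine ⟨fun x y hxy => hR.inj ?_, fun ⟨k, i⟩ => ?_⟩
    · exact congrArg (fun z : Σ k, Fin (m k) => (z.1, (z.2 : ℕ))) hxy
    · obtain ⟨x, hx⟩ := (hR.mem k i).2 i.isLt
      refine ⟨x, ?_⟩
      simp only [f]
      congr 1
      · rw [hx]
      · rw [Fin.heq_ext_iff (by rw [hx])]
        simp [hx]
  refine ⟨(Equiv.ofBijective f hf).trans (blkEquiv m), fun i => ?_⟩
  rw [Equiv.trans_apply, Equiv.symm_apply_apply]
  rfl

/-- Up to sign, a tau function is the determinant of the moments for any enumeration of the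
row and column labels. -/
theorem abs_TT {q p r : ℕ} {I : Type*} [Fintype I] [DecidableEq I] {m : Fin q → ℕ} {n : Fin p → ℕ}
    (c : Fin (2 * r) → ℝ) (a : Fin q → ℝ) (b : Fin p → ℝ) (al : Fin q → ℝ) (be : Fin p → ℝ)
    {R : I → Fin q × ℕ} {C : I → Fin p × ℕ} (hR : IsEnum m R) (hC : IsEnum n C) (st : TS q p) :
    |TT m n c a b al be st| = |(colMat (momentRows c a b al be R st) C).det| := by
  obtain ⟨eR, heR⟩ := hR.exists_equiv
  obtain ⟨eC, heC⟩ := hC.exists_equiv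
  have h : ∑ l, n l = ∑ k, m k := by
    simpa using Fintype.card_congr (eC.symm.trans eR)
  rw [TT, tauGen, dif_pos h, ← abs_det_submatrix_equiv_equiv eR (eC.trans (finCongr h))]
  congr 2
  ext i j
  have hcj : finCongr h.symm ((eC.trans (finCongr h)) j) = eC j := by ext; simp
  simp only [submatrix_apply, of_apply, colMat, momentRows, moment, heR, heC]
  rw [hcj]

theorem colMat_update {p : ℕ} {I : Type*} [DecidableEq I] (A : I → Fin p × ℕ → ℝ)
    (C : I → Fin p × ℕ) (i : I) (u : Fin p × ℕ) :
    colMat A (Function.update C i u) = (colMat A C).updateCol i fun j => A j u := by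
  ext x y
  rcases eq_or_ne y i with rfl | hy
  · simp [colMat]
  · simp [colMat, hy]

end Enumerations

section Border

open Matrix

variable {p : ℕ} {I : Type*} [Fintype I] [DecidableEq I]

theorem det_colMat_option {A : I → Fin p × ℕ → ℝ} {C : I → Fin p × ℕ}
    (hdet : (colMat A C).det ≠ 0) (ρ : Fin p × ℕ → ℝ) (u : Fin p × ℕ) :
    (colMat (fun o : Option I => o.elim ρ A) (fun o : Option I => o.elim u C)).det =
      (colMat A C).det * schur A C ρ u := by
  let _ := invertibleOfIsUnitDet (colMat A C) (isUnit_iff_ne_zero.2 hdet)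
  have h : colMat (fun o : Option I => o.elim ρ A) (fun o : Option I => o.elim u C) =
      (fromBlocks (colMat A C) (of fun i (_ : PUnit.{1}) => A i u)
        (of fun (_ : PUnit.{1}) j => ρ (C j)) (of fun _ _ => ρ u)).submatrix
          (Equiv.optionEquivSumPUnit I) (Equiv.optionEquivSumPUnit I) := by
    ext (_ | i) (_ | j) <;> simp [colMat]
  rw [h, det_submatrix_equiv_self, det_fromBlocks₁₁, invOf_eq_nonsing_inv, schur]
  congr 1
  rw [Matrix.mul_assoc]
  exact det_unique _

theorem inv_mulVec_single_none {M : Matrix (Option I) (Option I) ℝ} (hdet : M.det ≠ 0) :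
    M.det * (M⁻¹ *ᵥ Pi.single none 1) none = (M.submatrix some some).det := by
  have h := congrFun (det_smul_inv_mulVec_eq_cramer M (Pi.single none 1)
    (isUnit_iff_ne_zero.2 hdet)) none
  rw [Pi.smul_apply, smul_eq_mul] at h
  rw [h, cramer_apply]
  have h2 : M.updateCol none (Pi.single none 1) =
      (fromBlocks (M.submatrix some some) 0
        (of fun (_ : PUnit.{1}) j => M none (some j)) 1).submatrix
          (Equiv.optionEquivSumPUnit I) (Equiv.optionEquivSumPUnit I) := by
    ext (_ | i) (_ | j) <;> simp
  rw [h2, det_submatrix_equiv_self, det_fromBlocks_zero₁₂, det_one, mul_one]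

end Border

section LogDerivatives

open Matrix Topology

variable {q p r : ℕ} {I : Type*} [Fintype I] [DecidableEq I] {m : Fin q → ℕ} {n : Fin p → ℕ}
  {c : Fin (2 * r) → ℝ} {a : Fin q → ℝ} {b : Fin p → ℝ} {al : Fin q → ℝ} {be : Fin p → ℝ}
  {R : I → Fin q × ℕ} {C : I → Fin p × ℕ}

theorem log_TT (hR : IsEnum m R) (hC : IsEnum n C) (st : TS q p) :
    Real.log (TT m n c a b al be st) =
      Real.log (colMat (momentRows c a b al be R st) C).det := by
  rw [← Real.log_abs, abs_TT c a b al be hR hC, Real.log_abs]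

theorem TT_ne_zero_iff (hR : IsEnum m R) (hC : IsEnum n C) (st : TS q p) :
    TT m n c a b al be st ≠ 0 ↔ (colMat (momentRows c a b al be R st) C).det ≠ 0 := by
  rw [← abs_ne_zero, abs_TT c a b al be hR hC, abs_ne_zero]

theorem eventually_det_ne_zero {st : TS q p} (hst : FinTimes st) (l : Fin p) {ν : ℕ} (hν : 1 ≤ ν)
    (hdet : (colMat (momentRows c a b al be R st) C).det ≠ 0) :
    ∀ᶠ h in 𝓝 (st.2 l ν), (colMat (momentRows c a b al be R (tLine l ν st h)) C).det ≠ 0 := by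
  refine (hasDerivAt_det (M := fun h => colMat (momentRows c a b al be R (tLine l ν st h)) C)
    fun i j => hasDerivAt_moment c a b al be hst (R i).1 l hν (R i).2
      (C j)).continuousAt.eventually_ne ?_
  rwa [tLine_self]

theorem dTts_log_TT (hR : IsEnum m R) (hC : IsEnum n C) {l : Fin p} {i₀ : I} (hn : 1 ≤ n l)
    (hi₀ : C i₀ = (l, n l - 1)) {st : TS q p} (hst : FinTimes st)
    (hdet : (colMat (momentRows c a b al be R st) C).det ≠ 0) :
    dTts l 1 (fun st' => Real.log (TT m n c a b al be st')) st =
      ((colMat (momentRows c a b al be R st) C)⁻¹ *ᵥ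
        fun i => momentRows c a b al be R st i (l, n l)) i₀ := by
  simp only [dTts, log_TT hR hC]
  have h := hasDerivAt_log_det (A := fun h => momentRows c a b al be R (tLine l 1 st h))
    (x := st.2 l 1) hC hn hi₀
    (fun i u => by
      rw [tLine_self]
      exact hasDerivAt_moment c a b al be hst (R i).1 l le_rfl (R i).2 u)
    (by rwa [tLine_self])
  rw [tLine_self] at h
  exact h.deriv

/-- The common mechanism behind the identities: `Φ` is a first logarithmic derivative, and `Q` the
logarithm of a ratio of neighbouring tau functions. -/
theorem dTts_eq_div (hC : IsEnum n C) {l : Fin p} {i₀ : I} (hn : 1 ≤ n l)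
    (hi₀ : C i₀ = (l, n l - 1)) {A : TS q p → I → Fin p × ℕ → ℝ} {ρ : TS q p → Fin p × ℕ → ℝ}
    {v : TS q p → I → ℝ} {st : TS q p} {κ : ℝ} {Φ Q : TS q p → ℝ}
    (hA : ∀ ν, 1 ≤ ν → ∀ i u,
      HasDerivAt (fun h => A (tLine l ν st h) i u) (shiftD l ν (A st i) u) (st.2 l ν))
    (hρ : ∀ ν, 1 ≤ ν → ∀ u,
      HasDerivAt (fun h => ρ (tLine l ν st h) u) (shiftD l ν (ρ st) u) (st.2 l ν))
    (hv : ∀ ν h, v (tLine l ν st h) = v st) (hdet : (colMat (A st) C).det ≠ 0)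
    (hΦ : ∀ ν, 1 ≤ ν → ∀ᶠ h in 𝓝 (st.2 l ν), Φ (tLine l ν st h) =
      κ * (fun j => ρ (tLine l ν st h) (C j)) ⬝ᵥ
        ((colMat (A (tLine l ν st h)) C)⁻¹ *ᵥ v (tLine l ν st h)))
    (hQ : ∀ᶠ h in 𝓝 (st.2 l 1), Q (tLine l 1 st h) =
      Real.log (schur (A (tLine l 1 st h)) C (ρ (tLine l 1 st h)) (l, n l) /
        ((colMat (A (tLine l 1 st h)) C)⁻¹ *ᵥ v (tLine l 1 st h)) i₀))
    (hne : dTts l 1 Φ st ≠ 0) :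
    dTts l 1 Q st = dTts l 2 Φ st / dTts l 1 Φ st := by
  have hv' : ∀ ν x, ∀ i, HasDerivAt (fun h => v (tLine l ν st h) i) 0 x := fun ν x i => by
    simpa only [hv] using hasDerivAt_const x (v st i)
  have e1 : dTts l 1 Φ st = κ * (schur (A st) C (ρ st) (l, n l) *
      ((colMat (A st) C)⁻¹ *ᵥ v st) i₀) := by
    refine (Filter.EventuallyEq.deriv_eq (hΦ 1 le_rfl)).trans (HasDerivAt.deriv ?_)
    have := hasDerivAt_dotProduct_one (A := fun h => A (tLine l 1 st h))
      (ρ := fun h => ρ (tLine l 1 st h)) (v := fun h => v (tLine l 1 st h)) (x := st.2 l 1)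
      hC hn hi₀ (by simpa only [tLine_self] using hA 1 le_rfl)
      (by simpa only [tLine_self] using hρ 1 le_rfl) (hv' 1 _) (by simpa only [tLine_self])
    simpa only [tLine_self] using this.const_mul κ
  have e2 : dTts l 2 Φ st = κ * (schur (A st) C (ρ st) (l, n l + 1) *
      ((colMat (A st) C)⁻¹ *ᵥ v st) i₀ +
        schur (A st) C (ρ st) (l, n l) * penult n C l ((colMat (A st) C)⁻¹ *ᵥ v st)) := by
    refine (Filter.EventuallyEq.deriv_eq (hΦ 2 one_le_two)).trans (HasDerivAt.deriv ?_)
    have := hasDerivAt_dotProduct_two (A := fun h => A (tLine l 2 st h))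
      (ρ := fun h => ρ (tLine l 2 st h)) (v := fun h => v (tLine l 2 st h)) (x := st.2 l 2)
      hC hn hi₀ (by simpa only [tLine_self] using hA 2 one_le_two)
      (by simpa only [tLine_self] using hρ 2 one_le_two) (hv' 2 _) (by simpa only [tLine_self])
    simpa only [tLine_self] using this.const_mul κ
  rw [e1] at hne
  have hκ := left_ne_zero_of_mul hne
  have hs := left_ne_zero_of_mul (right_ne_zero_of_mul hne)
  have hy := right_ne_zero_of_mul (right_ne_zero_of_mul hne)
  rw [e1, e2, mul_div_mul_left _ _ hκ]
  refine (Filter.EventuallyEq.deriv_eq hQ).trans (HasDerivAt.deriv ?_)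
  have := hasDerivAt_log_schur_div (A := fun h => A (tLine l 1 st h))
    (ρ := fun h => ρ (tLine l 1 st h)) (v := fun h => v (tLine l 1 st h)) (x := st.2 l 1)
    hC hn hi₀ (by simpa only [tLine_self] using hA 1 le_rfl)
    (by simpa only [tLine_self] using hρ 1 le_rfl) (hv' 1 _) (by simpa only [tLine_self])
    (by simpa only [tLine_self]) (by simpa only [tLine_self])
  simpa only [tLine_self] using this

theorem dTts_log_TT_ratio_of_ne (hsum : ∑ l, n l = ∑ k, m k) {l l' : Fin p} (hl : l ≠ l')
    (hn : 1 ≤ n l) (hn' : 1 ≤ n l') {st : TS q p} (hst : FinTimes st)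
    (hτ : TT m n c a b al be st ≠ 0)
    (hne : dTts l 1 (dTts l' 1 (fun st' => Real.log (TT m n c a b al be st'))) st ≠ 0) :
    dTts l 1 (fun st' => Real.log
        (TT m (Function.update (Function.update n l (n l + 1)) l' (n l' - 1)) c a b al be st' /
          TT m (Function.update (Function.update n l (n l - 1)) l' (n l' + 1)) c a b al be st'))
        st
      = dTts l 2 (dTts l' 1 (fun st' => Real.log (TT m n c a b al be st'))) st /
          dTts l 1 (dTts l' 1 (fun st' => Real.log (TT m n c a b al be st'))) st := by
  obtain ⟨R, C, hR, hC⟩ := exists_isEnum_pair hsum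
  obtain ⟨i, hi⟩ := (hC.mem l (n l - 1)).2 (by omega)
  obtain ⟨i', hi'⟩ := (hC.mem l' (n l' - 1)).2 (by omega)
  have hdet := (TT_ne_zero_iff hR hC st).1 hτ
  have hunit : ∀ st', (fun j => if C j = C i' then (1 : ℝ) else 0) ⬝ᵥ
      ((colMat (momentRows c a b al be R st') C)⁻¹ *ᵥ
        fun x => momentRows c a b al be R st' x (l', n l')) =
      ((colMat (momentRows c a b al be R st') C)⁻¹ *ᵥ
        fun x => momentRows c a b al be R st' x (l', n l')) i' := by
    intro st'
    simp [dotProduct, hC.inj.eq_iff]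
  refine dTts_eq_div (A := momentRows c a b al be R) (C := C)
    (ρ := fun _ u => if u = C i' then 1 else 0)
    (v := fun st' x => momentRows c a b al be R st' x (l', n l')) (κ := 1) hC hn hi
    (fun ν hν x u => hasDerivAt_moment c a b al be hst (R x).1 l hν (R x).2 u) ?_ ?_ hdet ?_ ?_ hne
  · intro ν _ u
    have : shiftD l ν (fun u => if u = C i' then (1 : ℝ) else 0) u = 0 := by
      simp [shiftD, hi', hl]
    rw [this]
    exact hasDerivAt_const _ _
  · intro ν h
    funext x
    simp [momentRows, moment, tLine, hl.symm]
  · intro ν hν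
    filter_upwards [eventually_det_ne_zero hst l hν hdet] with h hh
    rw [dTts_log_TT hR hC hn' hi' (finTimes_tLine hst l ν h) hh, hunit, one_mul]
  · filter_upwards [eventually_det_ne_zero hst l le_rfl hdet] with h hh
    set st' := tLine l 1 st h
    have hC₁ := hC.update hl hn' hi'
    have hC₂ := hC.update hl.symm hn hi
    rw [Function.update_comm hl.symm] at hC₂
    have hcr : ∀ u x, (colMat (momentRows c a b al be R st') (Function.update C x u)).det =
        (colMat (momentRows c a b al be R st') C).det *
          ((colMat (momentRows c a b al be R st') C)⁻¹ *ᵥ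
            fun y => momentRows c a b al be R st' y u) x := by
      intro u x
      have := congrFun (det_smul_inv_mulVec_eq_cramer _
        (fun y => momentRows c a b al be R st' y u) (isUnit_iff_ne_zero.2 hh)) x
      rw [Pi.smul_apply, smul_eq_mul, cramer_apply] at this
      rw [this, colMat_update]
    have hs : schur (momentRows c a b al be R st') C (fun u => if u = C i' then 1 else 0) (l, n l)
        = -((colMat (momentRows c a b al be R st') C)⁻¹ *ᵥ
            fun y => momentRows c a b al be R st' y (l, n l)) i' := by
      have hne : (l, n l) ≠ C i' := by
        rw [hi']
        exact fun h => hl (Prod.mk.inj h).1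
      simp [schur, hne, dotProduct, hC.inj.eq_iff]
    rw [← Real.log_abs, abs_div, abs_TT c a b al be hR hC₁, abs_TT c a b al be hR hC₂, ← abs_div,
      Real.log_abs, hcr, hcr, mul_div_mul_left _ _ hh, hs, neg_div, Real.log_neg_eq_log]

end LogDerivatives

section TimeSwap

variable {q p r : ℕ}

/-- Exchanging the roles of the row and column times, with a change of sign. -/
def tSwap (st : TS q p) : TS p q :=
  (-st.2, -st.1)

theorem tSwap_tSwap (st : TS q p) : tSwap (tSwap st) = st := by
  simp [tSwap]

theorem finTimes_tSwap {st : TS q p} (hst : FinTimes st) : FinTimes (tSwap st) := by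
  simpa [FinTimes, tSwap] using hst.symm

theorem dSts_comp_tSwap (g : TS p q → ℝ) (k : Fin q) (ν : ℕ) (st : TS q p) :
    dSts k ν (fun st' => g (tSwap st')) st = -dTts k ν g (tSwap st) := by
  have h : ∀ h, tSwap (Function.update st.1 k (Function.update (st.1 k) ν h), st.2) =
      tLine k ν (tSwap st) (-h) := by
    intro h
    simp only [tSwap, tLine, Pi.neg_apply, ← Function.update_neg]
  simp only [dSts, h]
  exact deriv_comp_neg (fun x => g (tLine k ν (tSwap st) x)) _

theorem dTts_comp_tSwap (g : TS p q → ℝ) (l : Fin p) (ν : ℕ) (st : TS q p) :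
    dTts l ν (fun st' => g (tSwap st')) st = -dSts l ν g (tSwap st) := by
  have h := dSts_comp_tSwap (fun st' => g (tSwap st')) l ν (tSwap st)
  simp only [tSwap_tSwap] at h
  rw [h, neg_neg]

theorem moment_tSwap (c : Fin (2 * r) → ℝ) (a : Fin q → ℝ) (b : Fin p → ℝ) (al : Fin q → ℝ)
    (be : Fin p → ℝ) (st : TS q p) (k : Fin q) (l : Fin p) (d : ℕ) :
    moment c b a be al (tSwap st) l k d = moment c a b al be st k l d := by
  simp only [moment, tSwap, Pi.neg_apply, neg_mul, finsum_neg_distrib]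
  congr! 5 with x
  ring

open Matrix in
theorem colMat_momentRows_tSwap {I : Type*} (c : Fin (2 * r) → ℝ) (a : Fin q → ℝ) (b : Fin p → ℝ)
    (al : Fin q → ℝ) (be : Fin p → ℝ) (R : I → Fin q × ℕ) (C : I → Fin p × ℕ) (st : TS q p) :
    colMat (momentRows c b a be al C (tSwap st)) R =
      (colMat (momentRows c a b al be R st) C)ᵀ := by
  ext i j
  simp [colMat, momentRows, moment_tSwap, add_comm]

theorem abs_TT_tSwap {m : Fin q → ℕ} {n : Fin p → ℕ} (h : ∑ l, n l = ∑ k, m k)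
    (c : Fin (2 * r) → ℝ) (a : Fin q → ℝ) (b : Fin p → ℝ) (al : Fin q → ℝ) (be : Fin p → ℝ)
    (st : TS q p) : |TT n m c b a be al (tSwap st)| = |TT m n c a b al be st| := by
  obtain ⟨R, C, hR, hC⟩ := exists_isEnum_pair h
  rw [abs_TT c a b al be hR hC, abs_TT c b a be al hC hR, colMat_momentRows_tSwap,
    Matrix.det_transpose]

theorem log_TT_tSwap {m : Fin q → ℕ} {n : Fin p → ℕ} (h : ∑ l, n l = ∑ k, m k)
    (c : Fin (2 * r) → ℝ) (a : Fin q → ℝ) (b : Fin p → ℝ) (al : Fin q → ℝ) (be : Fin p → ℝ)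
    (st : TS q p) :
    Real.log (TT m n c a b al be st) = Real.log (TT n m c b a be al (tSwap st)) := by
  rw [← Real.log_abs, ← abs_TT_tSwap h, Real.log_abs]

theorem log_TT_div_tSwap {m m' : Fin q → ℕ} {n n' : Fin p → ℕ} (h : ∑ l, n l = ∑ k, m k)
    (h' : ∑ l, n' l = ∑ k, m' k)
    (c : Fin (2 * r) → ℝ) (a : Fin q → ℝ) (b : Fin p → ℝ) (al : Fin q → ℝ) (be : Fin p → ℝ)
    (st : TS q p) :
    Real.log (TT m n c a b al be st / TT m' n' c a b al be st) =
      -Real.log (TT n' m' c b a be al (tSwap st) / TT n m c b a be al (tSwap st)) := by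
  rw [← Real.log_inv, inv_div, ← Real.log_abs, abs_div, ← abs_TT_tSwap h, ← abs_TT_tSwap h',
    ← abs_div, Real.log_abs]

theorem dSts_log_TT_div_tSwap {m m' : Fin q → ℕ} {n n' : Fin p → ℕ} (h : ∑ l, n l = ∑ k, m k)
    (h' : ∑ l, n' l = ∑ k, m' k)
    (c : Fin (2 * r) → ℝ) (a : Fin q → ℝ) (b : Fin p → ℝ) (al : Fin q → ℝ) (be : Fin p → ℝ)
    (k : Fin q) (ν : ℕ) (st : TS q p) :
    dSts k ν (fun st' => Real.log (TT m n c a b al be st' / TT m' n' c a b al be st')) st =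
      dTts k ν (fun st' => Real.log (TT n' m' c b a be al st' / TT n m c b a be al st'))
        (tSwap st) := by
  simp only [log_TT_div_tSwap h h']
  rw [dSts_comp_tSwap (fun st' => -Real.log (TT n' m' c b a be al st' / TT n m c b a be al st'))]
  simp only [dTts, deriv.fun_neg, neg_neg]

theorem dSts_dSts_log_TT {m : Fin q → ℕ} {n : Fin p → ℕ} (h : ∑ l, n l = ∑ k, m k)
    (c : Fin (2 * r) → ℝ) (a : Fin q → ℝ) (b : Fin p → ℝ) (al : Fin q → ℝ) (be : Fin p → ℝ)
    (k k' : Fin q) (ν ν' : ℕ) (st : TS q p) :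
    dSts k ν (dSts k' ν' (fun st' => Real.log (TT m n c a b al be st'))) st =
      dTts k ν (dTts k' ν' (fun st' => Real.log (TT n m c b a be al st'))) (tSwap st) := by
  simp only [log_TT_tSwap h]
  rw [funext fun st' => dSts_comp_tSwap (fun st' => Real.log (TT n m c b a be al st')) k' ν' st',
    dSts_comp_tSwap
      (fun st' => -dTts k' ν' (fun st' => Real.log (TT n m c b a be al st')) st')]
  conv_lhs => rw [dTts]
  simp only [deriv.fun_neg, neg_neg]
  rfl

theorem dSts_dTts_log_TT {m : Fin q → ℕ} {n : Fin p → ℕ} (h : ∑ l, n l = ∑ k, m k)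
    (c : Fin (2 * r) → ℝ) (a : Fin q → ℝ) (b : Fin p → ℝ) (al : Fin q → ℝ) (be : Fin p → ℝ)
    (k : Fin q) (l : Fin p) (ν ν' : ℕ) (st : TS q p) :
    dSts k ν (dTts l ν' (fun st' => Real.log (TT m n c a b al be st'))) st =
      dTts k ν (dSts l ν' (fun st' => Real.log (TT n m c b a be al st'))) (tSwap st) := by
  simp only [log_TT_tSwap h]
  rw [funext fun st' => dTts_comp_tSwap (fun st' => Real.log (TT n m c b a be al st')) l ν' st',
    dSts_comp_tSwap
      (fun st' => -dSts l ν' (fun st' => Real.log (TT n m c b a be al st')) st')]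
  conv_lhs => rw [dTts]
  simp only [deriv.fun_neg, neg_neg]
  rfl

end TimeSwap

section MixedRatio

open Matrix Topology

theorem sum_update_add {q : ℕ} (m : Fin q → ℕ) (k : Fin q) (j : ℕ) :
    ∑ i, Function.update m k j i + m k = ∑ i, m i + j := by
  rw [Finset.sum_update_of_mem (Finset.mem_univ k),
    ← Finset.sum_sdiff (Finset.singleton_subset_iff.2 (Finset.mem_univ k)), Finset.sum_singleton]
  omega

variable {q p r : ℕ} {m : Fin q → ℕ} {n : Fin p → ℕ} {c : Fin (2 * r) → ℝ} {a : Fin q → ℝ}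
  {b : Fin p → ℝ} {al : Fin q → ℝ} {be : Fin p → ℝ}

theorem dTts_log_TT_ratio_mixed (hsum : ∑ l, n l = ∑ k, m k) {k : Fin q} {l : Fin p}
    (hm : 1 ≤ m k) (hn : 1 ≤ n l) {st : TS q p} (hst : FinTimes st)
    (hτ : TT m n c a b al be st ≠ 0)
    (hne : dTts l 1 (dSts k 1 (fun st' => Real.log (TT m n c a b al be st'))) st ≠ 0) :
    dTts l 1 (fun st' => Real.log
        (TT (Function.update m k (m k + 1)) (Function.update n l (n l + 1)) c a b al be st' /
          TT (Function.update m k (m k - 1)) (Function.update n l (n l - 1)) c a b al be st'))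
        st
      = dTts l 2 (dSts k 1 (fun st' => Real.log (TT m n c a b al be st'))) st /
          dTts l 1 (dSts k 1 (fun st' => Real.log (TT m n c a b al be st'))) st := by
  have hsum' : ∑ i, Function.update n l (n l - 1) i = ∑ i, Function.update m k (m k - 1) i := by
    have h1 := sum_update_add m k (m k - 1)
    have h2 := sum_update_add n l (n l - 1)
    omega
  have hoption : ∀ {p : ℕ} {I : Type} {n : Fin p → ℕ} {C : I → Fin p × ℕ} {l : Fin p}, 1 ≤ n l →
      IsEnum (Function.update n l (n l - 1)) C →
      IsEnum n (fun o : Option I => o.elim (l, n l - 1) C) := by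
    intro p I n C l hn hC
    simpa [Nat.sub_add_cancel hn] using hC.option l
  obtain ⟨R₀, C₀, hR₀, hC₀⟩ := exists_isEnum_pair hsum'
  set R := fun o : Option (Σ i, Fin (Function.update m k (m k - 1) i)) =>
    o.elim (k, m k - 1) R₀
  set C := fun o : Option (Σ i, Fin (Function.update m k (m k - 1) i)) =>
    o.elim (l, n l - 1) C₀
  have hR : IsEnum m R := hoption hm hR₀
  have hC : IsEnum n C := hoption hn hC₀
  have hdet := (TT_ne_zero_iff hR hC st).1 hτ
  refine dTts_eq_div (A := momentRows c a b al be R) (C := C) (i₀ := none)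
    (ρ := fun st' u => moment c a b al be st' k u.1 (m k + u.2))
    (v := fun _ => Pi.single none 1) (κ := -1) hC hn rfl
    (fun ν hν x u => hasDerivAt_moment c a b al be hst (R x).1 l hν (R x).2 u)
    (fun ν hν u => hasDerivAt_moment c a b al be hst k l hν (m k) u) (fun _ _ => rfl) hdet ?_ ?_ hne
  · intro ν hν
    filter_upwards [eventually_det_ne_zero hst l hν hdet] with h hh
    have hst' := finTimes_tLine hst l ν h
    set st' := tLine l ν st h
    simp only [log_TT_tSwap hsum]
    rw [dSts_comp_tSwap (fun st' => Real.log (TT n m c b a be al st')),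
      dTts_log_TT hC hR hm (i₀ := none) rfl (finTimes_tSwap hst')
        (by rwa [colMat_momentRows_tSwap, det_transpose]), colMat_momentRows_tSwap,
      ← transpose_nonsing_inv, mulVec_transpose, dotProduct_mulVec, dotProduct_single_one,
      neg_one_mul]
    congr 3
    funext j
    simp only [momentRows, moment_tSwap, add_comm]
  · filter_upwards [eventually_det_ne_zero hst l le_rfl hdet] with h hh
    set st' := tLine l 1 st h
    rw [← Real.log_abs, abs_div, abs_TT c a b al be (hR.option k) (hC.option l),
      abs_TT c a b al be hR₀ hC₀, ← abs_div, Real.log_abs]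
    have hrows : momentRows c a b al be (fun o : Option _ => o.elim (k, m k) R) st' =
        fun o => o.elim (fun u => moment c a b al be st' k u.1 (m k + u.2))
          (momentRows c a b al be R st') := by
      funext o u
      cases o <;> rfl
    rw [hrows, det_colMat_option hh]
    have hsub : colMat (momentRows c a b al be R₀ st') C₀ =
        (colMat (momentRows c a b al be R st') C).submatrix some some := rfl
    rw [hsub, ← inv_mulVec_single_none hh, mul_div_mul_left _ _ hh]

end MixedRatio

/-- **Corollary 3.3**: the four identities (a)–(d) relating first logarithmic derivatives of
ratios of shifted tau functions to ratios of second logarithmic derivatives of `τ^E_{m,n}`,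
valid at every point where all the tau functions involved are positive and the relevant
denominators are nonzero. -/
theorem log_tau_ratio_identities (q p r : ℕ) (hq : 1 ≤ q) (hp : 1 ≤ p)
    (m : Fin q → ℕ) (n : Fin p → ℕ) (hm1 : ∀ i, 1 ≤ m i) (hn1 : ∀ i, 1 ≤ n i)
    (hsum : ∑ i, n i = ∑ i, m i)
    (a : Fin q → ℝ) (b : Fin p → ℝ) (al : Fin q → ℝ) (be : Fin p → ℝ)
    (c : Fin (2 * r) → ℝ) (hc : StrictMono c)
    (st : TS q p) (hs : ∀ i, (Function.support (st.1 i)).Finite)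
    (ht : ∀ i, (Function.support (st.2 i)).Finite) :
    -- (a)
    (∀ l l' : Fin p, l ≠ l' → 1 ≤ n l → 1 ≤ n l' →
      0 < TT m n c a b al be st →
      0 < TT m (Function.update (Function.update n l (n l + 1)) l' (n l' - 1)) c a b al be st →
      0 < TT m (Function.update (Function.update n l (n l - 1)) l' (n l' + 1)) c a b al be st →
      dTts l 1 (dTts l' 1 (fun st' => Real.log (TT m n c a b al be st'))) st ≠ 0 →
      dTts l 1 (fun st' => Real.log
          (TT m (Function.update (Function.update n l (n l + 1)) l' (n l' - 1)) c a b al be st' /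
            TT m (Function.update (Function.update n l (n l - 1)) l' (n l' + 1)) c a b al be st'))
          st
        = dTts l 2 (dTts l' 1 (fun st' => Real.log (TT m n c a b al be st'))) st /
            dTts l 1 (dTts l' 1 (fun st' => Real.log (TT m n c a b al be st'))) st) ∧
    -- (b)
    (∀ k k' : Fin q, k ≠ k' → 1 ≤ m k → 1 ≤ m k' →
      0 < TT m n c a b al be st →
      0 < TT (Function.update (Function.update m k (m k - 1)) k' (m k' + 1)) n c a b al be st →
      0 < TT (Function.update (Function.update m k (m k + 1)) k' (m k' - 1)) n c a b al be st →
      dSts k 1 (dSts k' 1 (fun st' => Real.log (TT m n c a b al be st'))) st ≠ 0 →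
      dSts k 1 (fun st' => Real.log
          (TT (Function.update (Function.update m k (m k - 1)) k' (m k' + 1)) n c a b al be st' /
            TT (Function.update (Function.update m k (m k + 1)) k' (m k' - 1)) n c a b al be st'))
          st
        = dSts k 2 (dSts k' 1 (fun st' => Real.log (TT m n c a b al be st'))) st /
            dSts k 1 (dSts k' 1 (fun st' => Real.log (TT m n c a b al be st'))) st) ∧
    -- (c)
    (∀ (k : Fin q) (l : Fin p), 1 ≤ m k → 1 ≤ n l →
      0 < TT m n c a b al be st →
      0 < TT (Function.update m k (m k + 1)) (Function.update n l (n l + 1)) c a b al be st →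
      0 < TT (Function.update m k (m k - 1)) (Function.update n l (n l - 1)) c a b al be st →
      dTts l 1 (dSts k 1 (fun st' => Real.log (TT m n c a b al be st'))) st ≠ 0 →
      dTts l 1 (fun st' => Real.log
          (TT (Function.update m k (m k + 1)) (Function.update n l (n l + 1)) c a b al be st' /
            TT (Function.update m k (m k - 1)) (Function.update n l (n l - 1)) c a b al be st'))
          st
        = dTts l 2 (dSts k 1 (fun st' => Real.log (TT m n c a b al be st'))) st /
            dTts l 1 (dSts k 1 (fun st' => Real.log (TT m n c a b al be st'))) st) ∧
    -- (d)
    (∀ (k : Fin q) (l : Fin p), 1 ≤ m k → 1 ≤ n l →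
      0 < TT m n c a b al be st →
      0 < TT (Function.update m k (m k + 1)) (Function.update n l (n l + 1)) c a b al be st →
      0 < TT (Function.update m k (m k - 1)) (Function.update n l (n l - 1)) c a b al be st →
      dSts k 1 (dTts l 1 (fun st' => Real.log (TT m n c a b al be st'))) st ≠ 0 →
      dSts k 1 (fun st' => Real.log
          (TT (Function.update m k (m k - 1)) (Function.update n l (n l - 1)) c a b al be st' /
            TT (Function.update m k (m k + 1)) (Function.update n l (n l + 1)) c a b al be st'))
          st
        = dSts k 2 (dTts l 1 (fun st' => Real.log (TT m n c a b al be st'))) st /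
            dSts k 1 (dTts l 1 (fun st' => Real.log (TT m n c a b al be st'))) st) := by
  have hst : FinTimes st := ⟨hs, ht⟩
  refine ⟨?_, ?_, ?_, ?_⟩
  · intro l l' hl hl1 hl1' hτ _ _ hne
    exact dTts_log_TT_ratio_of_ne hsum hl hl1 hl1' hst hτ.ne' hne
  · intro k k' hk hk1 hk1' hτ _ _ hne
    rw [dSts_dSts_log_TT hsum] at hne ⊢
    have h1 := sum_update_add m k (m k - 1)
    have h2 := sum_update_add m k (m k + 1)
    have h3 := sum_update_add (Function.update m k (m k - 1)) k' (m k' + 1)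
    have h4 := sum_update_add (Function.update m k (m k + 1)) k' (m k' - 1)
    rw [Function.update_of_ne hk.symm] at h3 h4
    rw [dSts_dSts_log_TT hsum, dSts_log_TT_div_tSwap (by omega) (by omega)]
    refine dTts_log_TT_ratio_of_ne hsum.symm hk hk1 hk1' (finTimes_tSwap hst) ?_ hne
    rw [← abs_ne_zero, abs_TT_tSwap hsum]
    exact abs_ne_zero.2 hτ.ne'
  · intro k l hk hl hτ _ _ hne
    exact dTts_log_TT_ratio_mixed hsum hk hl hst hτ.ne' hne
  · intro k l hk hl hτ _ _ hne
    have h1 := sum_update_add m k (m k - 1)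
    have h2 := sum_update_add n l (n l - 1)
    have h3 := sum_update_add m k (m k + 1)
    have h4 := sum_update_add n l (n l + 1)
    rw [dSts_dTts_log_TT hsum] at hne ⊢
    rw [dSts_dTts_log_TT hsum, dSts_log_TT_div_tSwap (by omega) (by omega)]
    refine dTts_log_TT_ratio_mixed hsum.symm hl hk (finTimes_tSwap hst) ?_ hne
    rw [← abs_ne_zero, abs_TT_tSwap hsum]
    exact abs_ne_zero.2 hτ.ne'
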